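/- Let D be a collection of upwards closed first-order definable dependencies. Then every sentence of FO(=(·), D), i.e., first-order logic with constancy atoms and D-atoms, is equivalent to some first-order sentence. -/

import Mathlib

/-- Formulas of first-order logic with team semantics, in negation normal form,
over a relational signature `σ` (with arities `ar`) extended with dependency
atoms indexed by `δ` (with arities `dar`).  Equality and inequality literals
are between tuples of variables; variables are natural numbers. -/
inductive TForm (σ : Type) (ar : σ → ℕ) (δ : Type) (dar : δ → ℕ) : Type
  | rel (r : σ) (ts : Fin (ar r) → ℕ)
  | nrel (r : σ) (ts : Fin (ar r) → ℕ)
  | eq (k : ℕ) (x y : Fin k → ℕ)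
  | neq (k : ℕ) (x y : Fin k → ℕ)
  | dep (d : δ) (xs : Fin (dar d) → ℕ)
  | and (φ ψ : TForm σ ar δ dar)
  | or (φ ψ : TForm σ ar δ dar)
  | ex (v : ℕ) (φ : TForm σ ar δ dar)
  | all (v : ℕ) (φ : TForm σ ar δ dar)

/-- A team over a model with carrier `M`: a set of assignments. -/
abbrev Team (M : Type) := Set (ℕ → M)

/-- `X(x̄)`: the relation of values of the tuple `x̄` in the team `X`. -/
def Team.rel {M : Type} (X : Team M) {k : ℕ} (xs : Fin k → ℕ) : Set (Fin k → M) :=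
  {t | ∃ s ∈ X, t = fun i => s (xs i)}

/-- An interpretation of a family of dependencies: for each index, an
isomorphism-invariant-style class of pairs (carrier, relation). -/
abbrev DepFam (δ : Type) (dar : δ → ℕ) := ∀ d : δ, ∀ M : Type, Set (Fin (dar d) → M) → Prop

/-- Lax team semantics. -/
def tsat {σ : Type} {ar : σ → ℕ} {δ : Type} {dar : δ → ℕ} {M : Type}
    (RI : ∀ r : σ, Set (Fin (ar r) → M)) (DI : DepFam δ dar) :
    TForm σ ar δ dar → Team M → Prop
  | .rel r ts, X => ∀ s ∈ X, (fun i => s (ts i)) ∈ RI r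
  | .nrel r ts, X => ∀ s ∈ X, (fun i => s (ts i)) ∉ RI r
  | .eq _ x y, X => ∀ s ∈ X, (fun i => s (x i)) = fun i => s (y i)
  | .neq _ x y, X => ∀ s ∈ X, (fun i => s (x i)) ≠ fun i => s (y i)
  | .dep d xs, X => DI d M (X.rel xs)
  | .and φ ψ, X => tsat RI DI φ X ∧ tsat RI DI ψ X
  | .or φ ψ, X => ∃ Y Z, X = Y ∪ Z ∧ tsat RI DI φ Y ∧ tsat RI DI ψ Z
  | .ex v φ, X => ∃ H : (ℕ → M) → Set M, (∀ s ∈ X, (H s).Nonempty) ∧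
      tsat RI DI φ {s' | ∃ s ∈ X, ∃ m ∈ H s, s' = Function.update s v m}
  | .all v φ, X => tsat RI DI φ {s' | ∃ s ∈ X, ∃ m : M, s' = Function.update s v m}

/-- Tarski (single-assignment) semantics; dependency atoms are treated as
trivially true (they are only meaningful for first-order formulas). -/
def ssat {σ : Type} {ar : σ → ℕ} {δ : Type} {dar : δ → ℕ} {M : Type}
    (RI : ∀ r : σ, Set (Fin (ar r) → M)) :
    TForm σ ar δ dar → (ℕ → M) → Prop
  | .rel r ts, s => (fun i => s (ts i)) ∈ RI r
  | .nrel r ts, s => (fun i => s (ts i)) ∉ RI r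
  | .eq _ x y, s => (fun i => s (x i)) = fun i => s (y i)
  | .neq _ x y, s => (fun i => s (x i)) ≠ fun i => s (y i)
  | .dep _ _, _ => True
  | .and φ ψ, s => ssat RI φ s ∧ ssat RI ψ s
  | .or φ ψ, s => ssat RI φ s ∨ ssat RI ψ s
  | .ex v φ, s => ∃ m : M, ssat RI φ (Function.update s v m)
  | .all v φ, s => ∀ m : M, ssat RI φ (Function.update s v m)

/-- A formula is first-order if it contains no dependency atoms. -/
def TForm.isFO {σ : Type} {ar : σ → ℕ} {δ : Type} {dar : δ → ℕ} :
    TForm σ ar δ dar → Prop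
  | .dep _ _ => False
  | .and φ ψ => φ.isFO ∧ ψ.isFO
  | .or φ ψ => φ.isFO ∧ ψ.isFO
  | .ex _ φ => φ.isFO
  | .all _ φ => φ.isFO
  | _ => True

/-- Free variables of a formula. -/
def TForm.free {σ : Type} {ar : σ → ℕ} {δ : Type} {dar : δ → ℕ} :
    TForm σ ar δ dar → Set ℕ
  | .rel _ ts => Set.range ts
  | .nrel _ ts => Set.range ts
  | .eq _ x y => Set.range x ∪ Set.range y
  | .neq _ x y => Set.range x ∪ Set.range y
  | .dep _ xs => Set.range xs
  | .and φ ψ => φ.free ∪ ψ.free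
  | .or φ ψ => φ.free ∪ ψ.free
  | .ex v φ => φ.free \ {v}
  | .all v φ => φ.free \ {v}

/-- The flattening `φᶠ`: replace every dependency atom by the trivially true
atom `⊤` (here rendered as the empty-tuple equality). -/
def TForm.flatten {σ : Type} {ar : σ → ℕ} {δ : Type} {dar : δ → ℕ} :
    TForm σ ar δ dar → TForm σ ar δ dar
  | .dep _ _ => .eq 0 Fin.elim0 Fin.elim0
  | .and φ ψ => .and φ.flatten ψ.flatten
  | .or φ ψ => .or φ.flatten ψ.flatten
  | .ex v φ => .ex v φ.flatten
  | .all v φ => .all v φ.flatten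
  | φ => φ

/-- Negation normal form of the negation of a (first-order) formula. -/
def TForm.neg {σ : Type} {ar : σ → ℕ} {δ : Type} {dar : δ → ℕ} :
    TForm σ ar δ dar → TForm σ ar δ dar
  | .rel r ts => .nrel r ts
  | .nrel r ts => .rel r ts
  | .eq k x y => .neq k x y
  | .neq k x y => .eq k x y
  | .dep d xs => .dep d xs
  | .and φ ψ => .or φ.neg ψ.neg
  | .or φ ψ => .and φ.neg ψ.neg
  | .ex v φ => .all v φ.neg
  | .all v φ => .ex v φ.neg

/-- `(ψ ↾ θ) := (¬θ) ∨ (θ ∧ ψ)`. -/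
def TForm.restrict {σ : Type} {ar : σ → ℕ} {δ : Type} {dar : δ → ℕ}
    (ψ θ : TForm σ ar δ dar) : TForm σ ar δ dar :=
  .or θ.neg (.and θ ψ)

/-- A family of dependencies is upwards closed. -/
def UpClosed {δ : Type} {dar : δ → ℕ} (DI : DepFam δ dar) : Prop :=
  ∀ (d : δ) (M : Type) (R S : Set (Fin (dar d) → M)), R ⊆ S → DI d M R → DI d M S

/-- The constancy dependency of arity `n`. -/
def ConstD (n : ℕ) : ∀ M : Type, Set (Fin n → M) → Prop :=
  fun _ R => ∀ t ∈ R, ∀ t' ∈ R, t = t'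

/-- A dependency of arity `n` is first-order definable. -/
def FODefinable (n : ℕ) (D : ∀ M : Type, Set (Fin n → M) → Prop) : Prop :=
  ∃ ψ : TForm Unit (fun _ => n) Empty (fun e => e.elim),
    ψ.free = ∅ ∧ ∀ (A : Type) (R : Set (Fin n → A)),
      D A R ↔ ∀ s : ℕ → A, ssat (fun _ => R) ψ s

open Function

section Locality

variable {σ : Type} {ar : σ → ℕ} {δ : Type} {dar : δ → ℕ} {M : Type}

lemma TForm.finite_free (ψ : TForm σ ar δ dar) : ψ.free.Finite := by
  induction ψ with
  | rel r ts => exact Set.finite_range _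
  | nrel r ts => exact Set.finite_range _
  | eq k x y => exact (Set.finite_range _).union (Set.finite_range _)
  | neq k x y => exact (Set.finite_range _).union (Set.finite_range _)
  | dep d xs => exact Set.finite_range _
  | and φ ψ ihφ ihψ => exact ihφ.union ihψ
  | or φ ψ ihφ ihψ => exact ihφ.union ihψ
  | ex v φ ih => exact ih.sdiff
  | all v φ ih => exact ih.sdiff

lemma Set.EqOn.update_of_diff {s s' : ℕ → M} {V : Set ℕ} {v : ℕ}
    (h : Set.EqOn s s' (V \ {v})) (m : M) :
    Set.EqOn (update s v m) (update s' v m) V := by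
  intro i hi
  by_cases hv : i = v
  · subst hv; simp
  · simp [hv, h ⟨hi, hv⟩]

/-- Tarski satisfaction depends only on the values of the free variables. -/
lemma ssat_congr (RI : ∀ r : σ, Set (Fin (ar r) → M)) (ψ : TForm σ ar δ dar)
    {s s' : ℕ → M} (h : Set.EqOn s s' ψ.free) : ssat RI ψ s ↔ ssat RI ψ s' := by
  induction ψ generalizing s s' with
  | rel r ts => simp only [ssat, fun i => h (Set.mem_range_self (f := ts) i)]
  | nrel r ts => simp only [ssat, fun i => h (Set.mem_range_self (f := ts) i)]
  | eq k x y =>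
    simp only [ssat, fun i => h (Or.inl (Set.mem_range_self (f := x) i)),
      fun i => h (Or.inr (Set.mem_range_self (f := y) i))]
  | neq k x y =>
    simp only [ssat, fun i => h (Or.inl (Set.mem_range_self (f := x) i)),
      fun i => h (Or.inr (Set.mem_range_self (f := y) i))]
  | dep d xs => rfl
  | and φ ψ ihφ ihψ =>
    exact and_congr (ihφ (h.mono Set.subset_union_left)) (ihψ (h.mono Set.subset_union_right))
  | or φ ψ ihφ ihψ =>
    exact or_congr (ihφ (h.mono Set.subset_union_left)) (ihψ (h.mono Set.subset_union_right))
  | ex v φ ih => exact exists_congr fun m => ih (h.update_of_diff m)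
  | all v φ ih => exact forall_congr' fun m => ih (h.update_of_diff m)

/-- Every assignment in `X` agrees on `V` with one in `Y`, and conversely. -/
def Team.Agree (V : Set ℕ) (X Y : Team M) : Prop :=
  (∀ s ∈ X, ∃ s' ∈ Y, Set.EqOn s s' V) ∧ ∀ s' ∈ Y, ∃ s ∈ X, Set.EqOn s s' V

lemma Team.Agree.mono {V W : Set ℕ} {X Y : Team M} (h : Team.Agree V X Y) (hW : W ⊆ V) :
    Team.Agree W X Y := by
  refine ⟨fun s hs => ?_, fun s hs => ?_⟩
  · obtain ⟨s', hs', e⟩ := h.1 s hs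
    exact ⟨s', hs', e.mono hW⟩
  · obtain ⟨s', hs', e⟩ := h.2 s hs
    exact ⟨s', hs', e.mono hW⟩

lemma Team.Agree.rel_eq {k : ℕ} {xs : Fin k → ℕ} {X Y : Team M}
    (h : Team.Agree (Set.range xs) X Y) : X.rel xs = Y.rel xs := by
  ext t
  constructor
  · rintro ⟨s, hs, rfl⟩
    obtain ⟨s', hs', e⟩ := h.1 s hs
    exact ⟨s', hs', funext fun i => e ⟨i, rfl⟩⟩
  · rintro ⟨s, hs, rfl⟩
    obtain ⟨s', hs', e⟩ := h.2 s hs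
    exact ⟨s', hs', funext fun i => (e ⟨i, rfl⟩).symm⟩

/-- The part of `Y` that matches a subteam `A` of `X` agrees with `A`. -/
lemma Team.Agree.restrict {V W : Set ℕ} {X Y A : Team M} (h : Team.Agree V X Y) (hA : A ⊆ X)
    (hW : W ⊆ V) : Team.Agree W A {s' ∈ Y | ∃ s ∈ A, Set.EqOn s s' V} := by
  refine ⟨fun s hs => ?_, fun s' ⟨_, s, hs, e⟩ => ⟨s, hs, e.mono hW⟩⟩
  obtain ⟨s', hs', e⟩ := h.1 s (hA hs)
  exact ⟨s', ⟨hs', s, hs, e⟩, e.mono hW⟩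

/-- Locality of lax team semantics. -/
lemma tsat_of_agree (RI : ∀ r : σ, Set (Fin (ar r) → M)) (DI : DepFam δ dar)
    (φ : TForm σ ar δ dar) {X Y : Team M} (h : Team.Agree φ.free X Y)
    (hX : tsat RI DI φ X) : tsat RI DI φ Y := by
  induction φ generalizing X Y with
  | rel r ts =>
    intro s' hs'
    obtain ⟨s, hs, e⟩ := h.2 s' hs'
    exact (ssat_congr RI (.rel r ts : TForm σ ar δ dar) e).1 (hX s hs)
  | nrel r ts =>
    intro s' hs'
    obtain ⟨s, hs, e⟩ := h.2 s' hs'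
    exact (ssat_congr RI (.nrel r ts : TForm σ ar δ dar) e).1 (hX s hs)
  | eq k x y =>
    intro s' hs'
    obtain ⟨s, hs, e⟩ := h.2 s' hs'
    exact (ssat_congr RI (.eq k x y : TForm σ ar δ dar) e).1 (hX s hs)
  | neq k x y =>
    intro s' hs'
    obtain ⟨s, hs, e⟩ := h.2 s' hs'
    exact (ssat_congr RI (.neq k x y : TForm σ ar δ dar) e).1 (hX s hs)
  | dep d xs =>
    have e : X.rel xs = Y.rel xs := Team.Agree.rel_eq h
    simpa only [tsat, e] using hX
  | and φ ψ ihφ ihψ =>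
    exact ⟨ihφ (h.mono Set.subset_union_left) hX.1, ihψ (h.mono Set.subset_union_right) hX.2⟩
  | or φ ψ ihφ ihψ =>
    obtain ⟨A, B, rfl, hA, hB⟩ := hX
    refine ⟨_, _, ?_,
      ihφ (h.restrict Set.subset_union_left Set.subset_union_left) hA,
      ihψ (h.restrict Set.subset_union_right Set.subset_union_right) hB⟩
    ext s'
    constructor
    · intro hs'
      obtain ⟨s, hs | hs, e⟩ := h.2 s' hs'
      · exact Or.inl ⟨hs', s, hs, e⟩
      · exact Or.inr ⟨hs', s, hs, e⟩
    · rintro (hs' | hs') <;> exact hs'.1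
  | ex v φ ih =>
    obtain ⟨H, hH, hX⟩ := hX
    refine ⟨fun s' => {m | ∃ s ∈ X, Set.EqOn s s' (φ.free \ {v}) ∧ m ∈ H s}, ?_, ih ?_ hX⟩
    · intro s' hs'
      obtain ⟨s, hs, e⟩ := h.2 s' hs'
      obtain ⟨m, hm⟩ := hH s hs
      exact ⟨m, s, hs, e, hm⟩
    · constructor
      · rintro _ ⟨s, hs, m, hm, rfl⟩
        obtain ⟨s', hs', e⟩ := h.1 s hs
        exact ⟨_, ⟨s', hs', m, ⟨s, hs, e, hm⟩, rfl⟩, e.update_of_diff m⟩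
      · rintro _ ⟨s', hs', m, ⟨s, hs, e, hm⟩, rfl⟩
        exact ⟨_, ⟨s, hs, m, hm, rfl⟩, e.update_of_diff m⟩
  | all v φ ih =>
    refine ih ?_ hX
    constructor
    · rintro _ ⟨s, hs, m, rfl⟩
      obtain ⟨s', hs', e⟩ := h.1 s hs
      exact ⟨_, ⟨s', hs', m, rfl⟩, e.update_of_diff m⟩
    · rintro _ ⟨s', hs', m, rfl⟩
      obtain ⟨s, hs, e⟩ := h.2 s' hs'
      exact ⟨_, ⟨s, hs, m, rfl⟩, e.update_of_diff m⟩

/-- A sentence holds in all singleton teams iff it holds in the team of all assignments. -/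
lemma forall_tsat_singleton_iff_univ [Nonempty M] (RI : ∀ r : σ, Set (Fin (ar r) → M))
    (DI : DepFam δ dar) (φ : TForm σ ar δ dar) (hφ : φ.free = ∅) :
    (∀ s : ℕ → M, tsat RI DI φ {s}) ↔ tsat RI DI φ Set.univ := by
  constructor
  · intro h
    let s : ℕ → M := Classical.arbitrary _
    exact tsat_of_agree RI DI φ (by simp [Team.Agree, hφ]) (h s)
  · intro h s
    exact tsat_of_agree RI DI φ (by simp [Team.Agree, hφ]) h

lemma ssat_neg {dar : Empty → ℕ} (RI : ∀ r : σ, Set (Fin (ar r) → M))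
    (ψ : TForm σ ar Empty dar) (s : ℕ → M) : ssat RI ψ.neg s ↔ ¬ ssat RI ψ s := by
  induction ψ generalizing s with
  | dep d xs => exact d.elim
  | rel r ts => simp [TForm.neg, ssat]
  | nrel r ts => simp [TForm.neg, ssat]
  | eq k x y => simp [TForm.neg, ssat]
  | neq k x y => simp [TForm.neg, ssat]
  | and φ ψ ihφ ihψ => simp only [TForm.neg, ssat, ihφ, ihψ, not_and_or]
  | or φ ψ ihφ ihψ => simp only [TForm.neg, ssat, ihφ, ihψ, not_or]
  | ex v φ ih => simp only [TForm.neg, ssat, ih, not_exists]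
  | all v φ ih => simp only [TForm.neg, ssat, ih, not_forall]

lemma TForm.free_foldr_all (ψ : TForm σ ar δ dar) (l : List ℕ) :
    (l.foldr TForm.all ψ).free = ψ.free \ {i | i ∈ l} := by
  induction l with
  | nil => simp
  | cons v l ih =>
    ext i
    simp only [List.foldr_cons, TForm.free, ih, Set.mem_sdiff, Set.mem_ofPred_eq,
      Set.mem_singleton_iff, List.mem_cons]
    tauto

lemma forall_ssat_foldr_all (RI : ∀ r : σ, Set (Fin (ar r) → M)) (ψ : TForm σ ar δ dar)
    (l : List ℕ) : (∀ s : ℕ → M, ssat RI (l.foldr TForm.all ψ) s) ↔ ∀ s : ℕ → M, ssat RI ψ s := by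
  induction l with
  | nil => rfl
  | cons v l ih =>
    rw [← ih]
    constructor
    · intro h s
      simpa using h s (s v)
    · exact fun h s m => h _

lemma TForm.exists_closure (ψ : TForm σ ar δ dar) :
    ∃ ψ' : TForm σ ar δ dar, ψ'.free = ∅ ∧
      ∀ (M : Type) (RI : ∀ r : σ, Set (Fin (ar r) → M)),
        (∀ s : ℕ → M, ssat RI ψ' s) ↔ ∀ s : ℕ → M, ssat RI ψ s := by
  refine ⟨ψ.finite_free.toFinset.toList.foldr TForm.all ψ, ?_,
    fun M RI => forall_ssat_foldr_all RI ψ _⟩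
  simp [TForm.free_foldr_all]

end Locality

section Join

variable {M : Type}

/-- Two assignments coded as a single one. -/
def joinAssign (p s : ℕ → M) : ℕ → M := fun i => Sum.elim p s (Equiv.natSumNatEquivNat.symm i)

/-- The variable of a joined assignment that carries the `i`-th variable of the first component. -/
def leftVar (i : ℕ) : ℕ := Equiv.natSumNatEquivNat (Sum.inl i)

/-- The variable of a joined assignment that carries the `i`-th variable of the second component. -/
def rightVar (i : ℕ) : ℕ := Equiv.natSumNatEquivNat (Sum.inr i)

/-- The variable renaming that acts as `f` on left and as `g` on right variables. -/
def joinVar (f g : ℕ → ℕ) : ℕ → ℕ := fun i => Sum.elim f g (Equiv.natSumNatEquivNat.symm i)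

@[simp]
lemma joinAssign_leftVar (p s : ℕ → M) (i : ℕ) : joinAssign p s (leftVar i) = p i := by
  simp [joinAssign, leftVar]

@[simp]
lemma joinAssign_rightVar (p s : ℕ → M) (i : ℕ) : joinAssign p s (rightVar i) = s i := by
  simp [joinAssign, rightVar]

@[simp]
lemma joinAssign_comp_leftVar (p s : ℕ → M) : joinAssign p s ∘ leftVar = p :=
  funext fun i => by simp

@[simp]
lemma joinAssign_comp_rightVar (p s : ℕ → M) : joinAssign p s ∘ rightVar = s :=
  funext fun i => by simp

lemma comp_joinVar (t : ℕ → M) (f g : ℕ → ℕ) :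
    t ∘ joinVar f g = joinAssign (t ∘ f) (t ∘ g) := by
  funext i
  simp only [comp_apply, joinVar, joinAssign]
  cases Equiv.natSumNatEquivNat.symm i <;> rfl

lemma leftVar_or_rightVar (i : ℕ) : (∃ j, i = leftVar j) ∨ ∃ j, i = rightVar j := by
  rcases h : Equiv.natSumNatEquivNat.symm i with j | j
  · exact Or.inl ⟨j, by rw [leftVar, ← h, Equiv.apply_symm_apply]⟩
  · exact Or.inr ⟨j, by rw [rightVar, ← h, Equiv.apply_symm_apply]⟩

lemma leftVar_ne_rightVar (i j : ℕ) : leftVar i ≠ rightVar j := by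
  simp only [leftVar, rightVar, ne_eq, EmbeddingLike.apply_eq_iff_eq, reduceCtorEq,
    not_false_eq_true]

lemma rightVar_injective : Injective rightVar := fun i j h => by
  simpa [rightVar] using h

end Join

section Definability

variable {σ : Type} {ar : σ → ℕ}

/-- First-order formulas over the relational signature `σ`. -/
abbrev FOForm (σ : Type) (ar : σ → ℕ) := TForm σ ar Empty (fun e => e.elim)

/-- A property of assignments, given uniformly for all structures. -/
abbrev Query (σ : Type) (ar : σ → ℕ) :=
  ∀ M : Type, (∀ r : σ, Set (Fin (ar r) → M)) → (ℕ → M) → Prop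

/-- The query is defined by a first-order formula. -/
def Query.IsFO (Q : Query σ ar) : Prop :=
  ∃ ψ : FOForm σ ar, ∀ M RI s, Q M RI s ↔ ssat RI ψ s

namespace Query.IsFO

variable {Q Q' : Query σ ar}

lemma congr (h : Q'.IsFO) (e : ∀ M RI s, Q M RI s ↔ Q' M RI s) : Q.IsFO := by
  obtain ⟨ψ, hψ⟩ := h
  exact ⟨ψ, fun M RI s => (e M RI s).trans (hψ M RI s)⟩

lemma and (h : Q.IsFO) (h' : Q'.IsFO) :
    Query.IsFO (fun M RI s => Q M RI s ∧ Q' M RI s : Query σ ar) := by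
  obtain ⟨ψ, hψ⟩ := h
  obtain ⟨ψ', hψ'⟩ := h'
  exact ⟨.and ψ ψ', fun M RI s => and_congr (hψ M RI s) (hψ' M RI s)⟩

lemma or (h : Q.IsFO) (h' : Q'.IsFO) :
    Query.IsFO (fun M RI s => Q M RI s ∨ Q' M RI s : Query σ ar) := by
  obtain ⟨ψ, hψ⟩ := h
  obtain ⟨ψ', hψ'⟩ := h'
  exact ⟨.or ψ ψ', fun M RI s => or_congr (hψ M RI s) (hψ' M RI s)⟩

lemma not (h : Q.IsFO) : Query.IsFO (fun M RI s => ¬ Q M RI s : Query σ ar) := by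
  obtain ⟨ψ, hψ⟩ := h
  exact ⟨ψ.neg, fun M RI s => (hψ M RI s).not.trans (ssat_neg RI ψ s).symm⟩

lemma imp (h : Q.IsFO) (h' : Q'.IsFO) :
    Query.IsFO (fun M RI s => Q M RI s → Q' M RI s : Query σ ar) :=
  (h.not.or h').congr fun _ _ _ => imp_iff_not_or

lemma ex (h : Q.IsFO) (v : ℕ) :
    Query.IsFO (fun M RI s => ∃ m : M, Q M RI (update s v m) : Query σ ar) := by
  obtain ⟨ψ, hψ⟩ := h
  exact ⟨.ex v ψ, fun M RI s => exists_congr fun m => hψ M RI _⟩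

lemma all (h : Q.IsFO) (v : ℕ) :
    Query.IsFO (fun M RI s => ∀ m : M, Q M RI (update s v m) : Query σ ar) := by
  obtain ⟨ψ, hψ⟩ := h
  exact ⟨.all v ψ, fun M RI s => forall_congr' fun m => hψ M RI _⟩

lemma true : Query.IsFO (fun _ _ _ => True : Query σ ar) :=
  ⟨.eq 0 Fin.elim0 Fin.elim0, fun M RI s => by simp [ssat]⟩

lemma eq {k : ℕ} (x y : Fin k → ℕ) :
    Query.IsFO (fun _ _ s => (fun i => s (x i)) = fun i => s (y i) : Query σ ar) :=
  ⟨.eq k x y, fun _ _ _ => Iff.rfl⟩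

lemma rel (r : σ) (ts : Fin (ar r) → ℕ) :
    Query.IsFO (fun _ RI s => (fun i => s (ts i)) ∈ RI r : Query σ ar) :=
  ⟨.rel r ts, fun _ _ _ => Iff.rfl⟩

end Query.IsFO

/-- Replacing a bound variable by one that is fresh for a renaming. -/
lemma ssat_update_comp_fresh {M : Type} (RI : ∀ r : σ, Set (Fin (ar r) → M)) (φ : FOForm σ ar)
    (ρ : ℕ → ℕ) (v w : ℕ) (hw : w ∉ ρ '' φ.free) (s : ℕ → M) (m : M) :
    ssat RI φ (update (s ∘ ρ) v m) ↔ ssat RI φ (update s w m ∘ update ρ v w) := by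
  refine ssat_congr RI φ fun i hi => ?_
  by_cases hv : i = v
  · subst hv; simp
  · have : ρ i ≠ w := fun e => hw ⟨i, hi, e⟩
    simp [hv, this]

/-- First-order formulas are closed under arbitrary renaming of variables. -/
lemma FOForm.exists_rename (ψ : FOForm σ ar) (ρ : ℕ → ℕ) :
    Query.IsFO (fun _ RI s => ssat RI ψ (s ∘ ρ) : Query σ ar) := by
  induction ψ generalizing ρ with
  | rel r ts => exact .rel r (ρ ∘ ts)
  | nrel r ts => exact (Query.IsFO.rel r (ρ ∘ ts)).not
  | eq k x y => exact .eq (ρ ∘ x) (ρ ∘ y)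
  | neq k x y => exact (Query.IsFO.eq (ρ ∘ x) (ρ ∘ y)).not
  | dep d xs => exact d.elim
  | and φ ψ ihφ ihψ => exact (ihφ ρ).and (ihψ ρ)
  | or φ ψ ihφ ihψ => exact (ihφ ρ).or (ihψ ρ)
  | ex v φ ih =>
    obtain ⟨w, hw⟩ := (φ.finite_free.image ρ).exists_notMem
    exact ((ih (update ρ v w)).ex w).congr fun M RI s =>
      exists_congr fun m => ssat_update_comp_fresh RI φ ρ v w hw s m
  | all v φ ih =>
    obtain ⟨w, hw⟩ := (φ.finite_free.image ρ).exists_notMem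
    exact ((ih (update ρ v w)).all w).congr fun M RI s =>
      forall_congr' fun m => ssat_update_comp_fresh RI φ ρ v w hw s m

lemma ssat_foldr_ex {M : Type} (RI : ∀ r : σ, Set (Fin (ar r) → M)) (ψ : FOForm σ ar)
    (l : List ℕ) (t : ℕ → M) :
    ssat RI (l.foldr TForm.ex ψ) t ↔ ∃ t' : ℕ → M, (∀ i ∉ l, t' i = t i) ∧ ssat RI ψ t' := by
  induction l generalizing t with
  | nil =>
    constructor
    · exact fun h => ⟨t, fun _ _ => rfl, h⟩
    · rintro ⟨t', e, h⟩
      rwa [show t' = t from funext fun i => e i (by simp)] at h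
  | cons v l ih =>
    simp only [List.foldr_cons, ssat, ih]
    constructor
    · rintro ⟨m, t', e, h⟩
      refine ⟨t', fun i hi => ?_, h⟩
      simp only [List.mem_cons, not_or] at hi
      rw [e i hi.2, update_of_ne hi.1]
    · rintro ⟨t', e, h⟩
      refine ⟨t' v, t', fun i hi => ?_, h⟩
      by_cases hv : i = v
      · subst hv; simp
      · rw [update_of_ne hv]
        exact e i (by simp [hv, hi])

namespace Query.IsFO

variable {Q : Query σ ar}

lemma comp (h : Q.IsFO) (ρ : ℕ → ℕ) :
    Query.IsFO (fun M RI s => Q M RI (s ∘ ρ) : Query σ ar) := by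
  obtain ⟨ψ, hψ⟩ := h
  exact (ψ.exists_rename ρ).congr fun M RI s => hψ M RI _

/-- Quantification over whole assignments preserves definability. -/
lemma exAssign (h : Q.IsFO) :
    Query.IsFO (fun M RI p => ∃ s : ℕ → M, Q M RI (joinAssign p s) : Query σ ar) := by
  classical
  obtain ⟨ψ, hψ⟩ := h
  let l := (ψ.finite_free.toFinset.filter (· ∈ Set.range rightVar)).toList
  have hl : ∀ i, i ∈ l ↔ i ∈ ψ.free ∧ i ∈ Set.range rightVar := by simp [l]
  have hfo : Query.IsFO (fun M RI t => ssat RI (l.foldr TForm.ex ψ) t : Query σ ar) :=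
    ⟨_, fun _ _ _ => Iff.rfl⟩
  refine (hfo.comp (joinVar id id)).congr fun M RI p => ?_
  rw [ssat_foldr_ex]
  simp only [hψ, comp_joinVar, comp_id]
  constructor
  · rintro ⟨s, hs⟩
    refine ⟨fun i => if i ∈ l then joinAssign p s i else joinAssign p p i,
      fun i hi => if_neg hi, (ssat_congr RI ψ fun i hi => ?_).1 hs⟩
    by_cases hi' : i ∈ l
    · simp [hi']
    · rcases leftVar_or_rightVar i with ⟨j, rfl⟩ | ⟨j, rfl⟩
      · simp
      · exact absurd ((hl _).2 ⟨hi, j, rfl⟩) hi'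
  · rintro ⟨t, ht, hs⟩
    refine ⟨t ∘ rightVar, (ssat_congr RI ψ fun i _ => ?_).1 hs⟩
    rcases leftVar_or_rightVar i with ⟨j, rfl⟩ | ⟨j, rfl⟩
    · rw [ht _ fun hi => ?_]
      · simp
      · obtain ⟨k, hk⟩ := ((hl _).1 hi).2
        exact leftVar_ne_rightVar j k hk.symm
    · simp

lemma allAssign (h : Q.IsFO) :
    Query.IsFO (fun M RI p => ∀ s : ℕ → M, Q M RI (joinAssign p s) : Query σ ar) :=
  h.not.exAssign.not.congr fun _ _ _ => by simp

/-- Updating the second component of a joined assignment is an ordinary quantifier. -/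
lemma exRight {P : ∀ M : Type, (∀ r : σ, Set (Fin (ar r) → M)) → (ℕ → M) → (ℕ → M) → Prop}
    (h : Query.IsFO (fun M RI t => P M RI (t ∘ leftVar) (t ∘ rightVar) : Query σ ar)) (v : ℕ) :
    Query.IsFO (fun M RI t => ∃ m, P M RI (t ∘ leftVar) (update (t ∘ rightVar) v m) :
      Query σ ar) := by
  refine (h.ex (rightVar v)).congr fun M RI t => exists_congr fun m => ?_
  have e₁ : update t (rightVar v) m ∘ leftVar = t ∘ leftVar :=
    funext fun i => update_of_ne (leftVar_ne_rightVar i v) _ _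
  rw [e₁, update_comp_eq_of_injective _ rightVar_injective]

lemma allRight {P : ∀ M : Type, (∀ r : σ, Set (Fin (ar r) → M)) → (ℕ → M) → (ℕ → M) → Prop}
    (h : Query.IsFO (fun M RI t => P M RI (t ∘ leftVar) (t ∘ rightVar) : Query σ ar)) (v : ℕ) :
    Query.IsFO (fun M RI t => ∀ m, P M RI (t ∘ leftVar) (update (t ∘ rightVar) v m) :
      Query σ ar) :=
  (exRight (P := fun M RI p s => ¬ P M RI p s) h.not v).not.congr fun _ _ _ => by simp

end Query.IsFO

/-- A team depending on parameters, given uniformly for all structures. -/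
abbrev TeamQuery (σ : Type) (ar : σ → ℕ) :=
  ∀ M : Type, (∀ r : σ, Set (Fin (ar r) → M)) → (ℕ → M) → Team M

/-- The parametrised team is defined by a first-order formula. -/
def TeamQuery.IsFO (X : TeamQuery σ ar) : Prop :=
  Query.IsFO (fun M RI t => t ∘ rightVar ∈ X M RI (t ∘ leftVar) : Query σ ar)

namespace TeamQuery.IsFO

variable {X Y : TeamQuery σ ar}

lemma inter (hX : X.IsFO) (hY : Y.IsFO) :
    TeamQuery.IsFO (fun M RI p => X M RI p ∩ Y M RI p : TeamQuery σ ar) :=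
  Query.IsFO.and hX hY

lemma subset (hX : X.IsFO) (hY : Y.IsFO) :
    Query.IsFO (fun M RI p => X M RI p ⊆ Y M RI p : Query σ ar) :=
  (Query.IsFO.imp hX hY).allAssign.congr fun M RI p => by
    simp only [joinAssign_comp_rightVar, joinAssign_comp_leftVar]; rfl

lemma all (hX : X.IsFO) (v : ℕ) :
    TeamQuery.IsFO (fun M RI p => {s' | ∃ s ∈ X M RI p, ∃ m : M, s' = update s v m} :
      TeamQuery σ ar) := by
  refine (Query.IsFO.exRight (P := fun M RI p s => s ∈ X M RI p) hX v).congr fun M RI t => ?_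
  constructor
  · rintro ⟨s, hs, m, e⟩
    exact ⟨s v, by simpa [e] using hs⟩
  · rintro ⟨m, hm⟩
    exact ⟨_, hm, t (rightVar v), by simp⟩

/-- The relation `X(x̄)` of a definable team may be used inside first-order formulas. -/
lemma ssat_rel (hX : X.IsFO) {n : ℕ} (xs : Fin n → ℕ) (ψ : FOForm Unit (fun _ => n)) :
    Query.IsFO (fun M RI t => ssat (fun _ => (X M RI (t ∘ leftVar)).rel xs) ψ (t ∘ rightVar) :
      Query σ ar) := by
  have key : ∀ ts : Fin n → ℕ, Query.IsFO (fun M RI t =>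
      (fun i => (t ∘ rightVar) (ts i)) ∈ (X M RI (t ∘ leftVar)).rel xs : Query σ ar) := by
    intro ts
    refine ((Query.IsFO.comp hX (joinVar (leftVar ∘ leftVar) rightVar)).and
      (Query.IsFO.eq (fun i => leftVar (rightVar (ts i)))
        (fun i => rightVar (xs i)))).exAssign.congr fun M RI t => ?_
    simp only [comp_joinVar, joinAssign_comp_rightVar, joinAssign_comp_leftVar, ← comp_assoc,
      joinAssign_leftVar, joinAssign_rightVar]
    rfl
  induction ψ with
  | rel r ts => exact key ts
  | nrel r ts => exact (key ts).not
  | eq k x y => exact .eq (rightVar ∘ x) (rightVar ∘ y)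
  | neq k x y => exact (Query.IsFO.eq (rightVar ∘ x) (rightVar ∘ y)).not
  | dep d xs => exact d.elim
  | and φ ψ ihφ ihψ => exact ihφ.and ihψ
  | or φ ψ ihφ ihψ => exact ihφ.or ihψ
  | ex v φ ih =>
    exact Query.IsFO.exRight (P := fun M RI p s => ssat (fun _ => (X M RI p).rel xs) φ s) ih v
  | all v φ ih =>
    exact Query.IsFO.allRight (P := fun M RI p s => ssat (fun _ => (X M RI p).rel xs) φ s) ih v

lemma dep (hX : X.IsFO) {n : ℕ} {D : ∀ M : Type, Set (Fin n → M) → Prop}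
    (hD : FODefinable n D) (xs : Fin n → ℕ) :
    Query.IsFO (fun M RI p => D M ((X M RI p).rel xs) : Query σ ar) := by
  obtain ⟨ψ, -, hψ⟩ := hD
  exact (hX.ssat_rel xs ψ).allAssign.congr fun M RI p => by
    simp only [hψ, joinAssign_comp_rightVar, joinAssign_comp_leftVar]

end TeamQuery.IsFO

end Definability

section Constancy

variable {σ : Type} {ar : σ → ℕ} {δ : Type} {dar : δ → ℕ} {M : Type}

/-- The dependencies of `DI` together with the constancy atoms. -/
def DepFam.withConst (DI : DepFam δ dar) : DepFam (δ ⊕ ℕ) (Sum.elim dar id) :=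
  fun d => Sum.casesOn (motive := fun d => ∀ M : Type, Set (Fin (Sum.elim dar id d) → M) → Prop)
    d DI ConstD

/-- The set of assignments satisfying the flattening of a formula in which each constancy atom
asserts equality with prescribed values, taken from `c`; the two sides of a conjunction or
disjunction use disjoint parts of `c`. -/
def flatSat (RI : ∀ r : σ, Set (Fin (ar r) → M)) :
    TForm σ ar (δ ⊕ ℕ) (Sum.elim dar id) → (ℕ → M) → Team M
  | .rel r ts, _ => {s | (fun i => s (ts i)) ∈ RI r}
  | .nrel r ts, _ => {s | (fun i => s (ts i)) ∉ RI r}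
  | .eq _ x y, _ => {s | (fun i => s (x i)) = fun i => s (y i)}
  | .neq _ x y, _ => {s | (fun i => s (x i)) ≠ fun i => s (y i)}
  | .dep (.inl _) _, _ => Set.univ
  | .dep (.inr n) xs, c => {s | (fun i : Fin n => s (xs i)) = fun i : Fin n => c i}
  | .and φ ψ, c => flatSat RI φ (c ∘ leftVar) ∩ flatSat RI ψ (c ∘ rightVar)
  | .or φ ψ, c => flatSat RI φ (c ∘ leftVar) ∪ flatSat RI ψ (c ∘ rightVar)
  | .ex v φ, c => {s | ∃ m : M, update s v m ∈ flatSat RI φ c}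
  | .all v φ, c => {s | ∀ m : M, update s v m ∈ flatSat RI φ c}

/-- Team satisfaction where constancy atoms assert equality with values prescribed by `c`, and
where disjunctions and existential quantifiers use the largest subteams compatible with the
flattening. -/
def maxSat (RI : ∀ r : σ, Set (Fin (ar r) → M)) (DI : DepFam δ dar) :
    TForm σ ar (δ ⊕ ℕ) (Sum.elim dar id) → (ℕ → M) → Team M → Prop
  | .rel r ts, c, X =>
      X ⊆ flatSat RI (.rel r ts : TForm σ ar (δ ⊕ ℕ) (Sum.elim dar id)) c
  | .nrel r ts, c, X =>
      X ⊆ flatSat RI (.nrel r ts : TForm σ ar (δ ⊕ ℕ) (Sum.elim dar id)) c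
  | .eq k x y, c, X =>
      X ⊆ flatSat RI (.eq k x y : TForm σ ar (δ ⊕ ℕ) (Sum.elim dar id)) c
  | .neq k x y, c, X =>
      X ⊆ flatSat RI (.neq k x y : TForm σ ar (δ ⊕ ℕ) (Sum.elim dar id)) c
  | .dep (.inl d) xs, _, X => DI d M (X.rel xs)
  | .dep (.inr n) xs, c, X =>
      X ⊆ flatSat RI (.dep (.inr n) xs : TForm σ ar (δ ⊕ ℕ) (Sum.elim dar id)) c
  | .and φ ψ, c, X => maxSat RI DI φ (c ∘ leftVar) X ∧ maxSat RI DI ψ (c ∘ rightVar) X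
  | .or φ ψ, c, X => X ⊆ flatSat RI (.or φ ψ) c ∧
      maxSat RI DI φ (c ∘ leftVar) (X ∩ flatSat RI φ (c ∘ leftVar)) ∧
      maxSat RI DI ψ (c ∘ rightVar) (X ∩ flatSat RI ψ (c ∘ rightVar))
  | .ex v φ, c, X => X ⊆ flatSat RI (.ex v φ) c ∧
      maxSat RI DI φ c ({s' | ∃ s ∈ X, ∃ m : M, s' = update s v m} ∩ flatSat RI φ c)
  | .all v φ, c, X => maxSat RI DI φ c {s' | ∃ s ∈ X, ∃ m : M, s' = update s v m}

lemma maxSat.subset_flatSat {RI : ∀ r : σ, Set (Fin (ar r) → M)} {DI : DepFam δ dar}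
    {φ : TForm σ ar (δ ⊕ ℕ) (Sum.elim dar id)} {c : ℕ → M} {X : Team M}
    (h : maxSat RI DI φ c X) : X ⊆ flatSat RI φ c := by
  induction φ generalizing c X with
  | rel r ts => exact h
  | nrel r ts => exact h
  | eq k x y => exact h
  | neq k x y => exact h
  | dep d xs =>
    cases d with
    | inl d => exact Set.subset_univ _
    | inr n => exact h
  | and φ ψ ihφ ihψ => exact Set.subset_inter (ihφ h.1) (ihψ h.2)
  | or φ ψ ihφ ihψ => exact h.1
  | ex v φ ih => exact h.1
  | all v φ ih => exact fun s hs m => ih h ⟨s, hs, m, rfl⟩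

/-- Upward closure below the flattening. -/
lemma maxSat.mono {RI : ∀ r : σ, Set (Fin (ar r) → M)} {DI : DepFam δ dar} (hup : UpClosed DI)
    {φ : TForm σ ar (δ ⊕ ℕ) (Sum.elim dar id)} {c : ℕ → M} {X Y : Team M}
    (h : maxSat RI DI φ c X) (hXY : X ⊆ Y) (hY : Y ⊆ flatSat RI φ c) : maxSat RI DI φ c Y := by
  have hall : ∀ {X Y : Team M} (v : ℕ), X ⊆ Y →
      {s' | ∃ s ∈ X, ∃ m : M, s' = update s v m} ⊆
        {s' | ∃ s ∈ Y, ∃ m : M, s' = update s v m} :=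
    fun v hXY _ ⟨s, hs, hm⟩ => ⟨s, hXY hs, hm⟩
  induction φ generalizing c X Y with
  | rel r ts => exact hY
  | nrel r ts => exact hY
  | eq k x y => exact hY
  | neq k x y => exact hY
  | dep d xs =>
    cases d with
    | inl d =>
      refine hup d M _ _ ?_ h
      rintro _ ⟨s, hs, rfl⟩
      exact ⟨s, hXY hs, rfl⟩
    | inr n => exact hY
  | and φ ψ ihφ ihψ =>
    exact ⟨ihφ h.1 hXY fun s hs => (hY hs).1, ihψ h.2 hXY fun s hs => (hY hs).2⟩
  | or φ ψ ihφ ihψ =>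
    exact ⟨hY, ihφ h.2.1 (Set.inter_subset_inter_left _ hXY) Set.inter_subset_right,
      ihψ h.2.2 (Set.inter_subset_inter_left _ hXY) Set.inter_subset_right⟩
  | ex v φ ih =>
    exact ⟨hY, ih h.2 (Set.inter_subset_inter_left _ (hall v hXY)) Set.inter_subset_right⟩
  | all v φ ih =>
    refine ih h (hall v hXY) ?_
    rintro _ ⟨s, hs, m, rfl⟩
    exact hY hs m

lemma tsat_of_maxSat {RI : ∀ r : σ, Set (Fin (ar r) → M)} {DI : DepFam δ dar}
    {φ : TForm σ ar (δ ⊕ ℕ) (Sum.elim dar id)} {c : ℕ → M} {X : Team M}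
    (h : maxSat RI DI φ c X) : tsat RI DI.withConst φ X := by
  induction φ generalizing c X with
  | rel r ts => exact h
  | nrel r ts => exact h
  | eq k x y => exact h
  | neq k x y => exact h
  | dep d xs =>
    cases d with
    | inl d => exact h
    | inr n =>
      rintro _ ⟨s, hs, rfl⟩ _ ⟨s', hs', rfl⟩
      exact (h hs).trans (h hs').symm
  | and φ ψ ihφ ihψ => exact ⟨ihφ h.1, ihψ h.2⟩
  | or φ ψ ihφ ihψ =>
    refine ⟨_, _, ?_, ihφ h.2.1, ihψ h.2.2⟩
    rw [← Set.inter_union_distrib_left]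
    exact (Set.inter_eq_left.2 h.1).symm
  | ex v φ ih =>
    refine ⟨fun s => {m | update s v m ∈ flatSat RI φ c}, h.1, ?_⟩
    convert ih h.2 using 1
    ext s'
    constructor
    · rintro ⟨s, hs, m, hm, rfl⟩
      exact ⟨⟨s, hs, m, rfl⟩, hm⟩
    · rintro ⟨⟨s, hs, m, rfl⟩, hm⟩
      exact ⟨s, hs, m, hm, rfl⟩
  | all v φ ih => exact ih h

lemma exists_maxSat_of_tsat [Nonempty M] {RI : ∀ r : σ, Set (Fin (ar r) → M)}
    {DI : DepFam δ dar} (hup : UpClosed DI) {φ : TForm σ ar (δ ⊕ ℕ) (Sum.elim dar id)}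
    {X : Team M} (h : tsat RI DI.withConst φ X) : ∃ c, maxSat RI DI φ c X := by
  have c₀ : ℕ → M := Classical.arbitrary _
  induction φ generalizing X with
  | rel r ts => exact ⟨c₀, h⟩
  | nrel r ts => exact ⟨c₀, h⟩
  | eq k x y => exact ⟨c₀, h⟩
  | neq k x y => exact ⟨c₀, h⟩
  | dep d xs =>
    cases d with
    | inl d => exact ⟨c₀, h⟩
    | inr n =>
      rcases X.eq_empty_or_nonempty with rfl | ⟨s₀, hs₀⟩
      · exact ⟨c₀, Set.empty_subset _⟩
      · refine ⟨fun i => if hi : i < n then s₀ (xs ⟨i, hi⟩) else c₀ i, fun s hs => ?_⟩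
        have e := h _ ⟨s, hs, rfl⟩ _ ⟨s₀, hs₀, rfl⟩
        refine funext fun i => ?_
        simpa using congrFun e i
  | and φ ψ ihφ ihψ =>
    obtain ⟨c, hc⟩ := ihφ h.1
    obtain ⟨c', hc'⟩ := ihψ h.2
    exact ⟨joinAssign c c', by simpa [maxSat] using ⟨hc, hc'⟩⟩
  | or φ ψ ihφ ihψ =>
    obtain ⟨Y, Z, rfl, hY, hZ⟩ := h
    obtain ⟨c, hc⟩ := ihφ hY
    obtain ⟨c', hc'⟩ := ihψ hZ
    refine ⟨joinAssign c c', ?_⟩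
    simp only [maxSat, flatSat, joinAssign_comp_leftVar, joinAssign_comp_rightVar]
    exact ⟨Set.union_subset_union hc.subset_flatSat hc'.subset_flatSat,
      hc.mono hup (Set.subset_inter Set.subset_union_left hc.subset_flatSat)
        Set.inter_subset_right,
      hc'.mono hup (Set.subset_inter Set.subset_union_right hc'.subset_flatSat)
        Set.inter_subset_right⟩
  | ex v φ ih =>
    obtain ⟨H, hH, h⟩ := h
    obtain ⟨c, hc⟩ := ih h
    refine ⟨c, fun s hs => ?_, hc.mono hup (Set.subset_inter ?_ hc.subset_flatSat)
      Set.inter_subset_right⟩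
    · obtain ⟨m, hm⟩ := hH s hs
      exact ⟨m, hc.subset_flatSat ⟨s, hs, m, hm, rfl⟩⟩
    · rintro _ ⟨s, hs, m, -, rfl⟩
      exact ⟨s, hs, m, rfl⟩
  | all v φ ih => exact ih h

/-- Truth of a sentence with upwards closed dependencies and constancy atoms amounts to the
existence of values for the constancy atoms; `E` is any presentation of `DI.withConst`. -/
lemma forall_tsat_singleton_iff_exists_maxSat [Nonempty M]
    (RI : ∀ r : σ, Set (Fin (ar r) → M)) {DI : DepFam δ dar} (hup : UpClosed DI)
    {E : DepFam (δ ⊕ ℕ) (Sum.elim dar id)}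
    (hl : ∀ d, E (.inl d) = DI d) (hr : ∀ n, E (.inr n) = ConstD n)
    (φ : TForm σ ar (δ ⊕ ℕ) (Sum.elim dar id)) (hφ : φ.free = ∅) :
    (∀ s : ℕ → M, tsat RI E φ {s}) ↔ ∃ c, maxSat RI DI φ c Set.univ := by
  have hE : E = DI.withConst := by
    funext d
    cases d with
    | inl d => exact hl d
    | inr n => exact hr n
  rw [hE, forall_tsat_singleton_iff_univ RI _ φ hφ]
  exact ⟨exists_maxSat_of_tsat hup, fun ⟨_, h⟩ => tsat_of_maxSat h⟩

lemma isFO_flatSat (φ : TForm σ ar (δ ⊕ ℕ) (Sum.elim dar id)) (f : ℕ → ℕ) :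
    TeamQuery.IsFO (fun _ RI p => flatSat RI φ (p ∘ f) : TeamQuery σ ar) := by
  induction φ generalizing f with
  | rel r ts => exact Query.IsFO.rel r (rightVar ∘ ts)
  | nrel r ts => exact (Query.IsFO.rel r (rightVar ∘ ts)).not
  | eq k x y => exact Query.IsFO.eq (rightVar ∘ x) (rightVar ∘ y)
  | neq k x y => exact (Query.IsFO.eq (rightVar ∘ x) (rightVar ∘ y)).not
  | dep d xs =>
    cases d with
    | inl d => exact Query.IsFO.true
    | inr n => exact Query.IsFO.eq (fun i : Fin n => rightVar (xs i)) (fun i => leftVar (f i))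
  | and φ ψ ihφ ihψ => exact Query.IsFO.and (ihφ (f ∘ leftVar)) (ihψ (f ∘ rightVar))
  | or φ ψ ihφ ihψ => exact Query.IsFO.or (ihφ (f ∘ leftVar)) (ihψ (f ∘ rightVar))
  | ex v φ ih =>
    exact Query.IsFO.exRight (P := fun M RI p s => s ∈ flatSat RI φ (p ∘ f)) (ih f) v
  | all v φ ih =>
    exact Query.IsFO.allRight (P := fun M RI p s => s ∈ flatSat RI φ (p ∘ f)) (ih f) v

lemma isFO_maxSat {DI : DepFam δ dar} (hdef : ∀ d : δ, FODefinable (dar d) (DI d))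
    (φ : TForm σ ar (δ ⊕ ℕ) (Sum.elim dar id)) (f : ℕ → ℕ) {X : TeamQuery σ ar} (hX : X.IsFO) :
    Query.IsFO (fun M RI p => maxSat RI DI φ (p ∘ f) (X M RI p) : Query σ ar) := by
  induction φ generalizing f X with
  | rel r ts => exact hX.subset (isFO_flatSat _ f)
  | nrel r ts => exact hX.subset (isFO_flatSat _ f)
  | eq k x y => exact hX.subset (isFO_flatSat _ f)
  | neq k x y => exact hX.subset (isFO_flatSat _ f)
  | dep d xs =>
    cases d with
    | inl d => exact hX.dep (hdef d) xs
    | inr n => exact hX.subset (isFO_flatSat _ f)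
  | and φ ψ ihφ ihψ => exact (ihφ (f ∘ leftVar) hX).and (ihψ (f ∘ rightVar) hX)
  | or φ ψ ihφ ihψ =>
    exact (hX.subset (isFO_flatSat (.or φ ψ) f)).and
      ((ihφ (f ∘ leftVar) (hX.inter (isFO_flatSat φ (f ∘ leftVar)))).and
        (ihψ (f ∘ rightVar) (hX.inter (isFO_flatSat ψ (f ∘ rightVar)))))
  | ex v φ ih =>
    exact (hX.subset (isFO_flatSat (.ex v φ) f)).and
      (ih f ((hX.all v).inter (isFO_flatSat φ f)))
  | all v φ ih => exact ih f (hX.all v)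

end Constancy

/-- **Upwards closed dependencies plus constancy.**  If every dependency in `D`
is upwards closed and first-order definable, then every sentence of
`FO(=(·), D)` (dependency atoms indexed by `δ ⊕ ℕ`, with `.inr m` the constancy
atom of arity `m`) is equivalent to a first-order sentence.  Truth of a
sentence in a model is satisfaction by a singleton team. -/
theorem upwards_const_fo {σ : Type} {ar : σ → ℕ} {δ : Type} {dar : δ → ℕ}
    (DI : DepFam δ dar) (hup : UpClosed DI)
    (hdef : ∀ d : δ, FODefinable (dar d) (DI d))
    (φ : TForm σ ar (δ ⊕ ℕ) (Sum.elim dar id)) (hφ : φ.free = ∅) :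
    ∃ ψ : TForm σ ar Empty (fun e => e.elim), ψ.free = ∅ ∧
      ∀ (M : Type) [Nontrivial M] (RI : ∀ r : σ, Set (Fin (ar r) → M)),
        (∀ s : ℕ → M,
          tsat RI (fun d => match d with | .inl d => DI d | .inr n => ConstD n) φ {s}) ↔
        (∀ s : ℕ → M, ssat RI ψ s) := by
  have huniv : TeamQuery.IsFO (fun _ _ _ => Set.univ : TeamQuery σ ar) := Query.IsFO.true
  obtain ⟨θ, hθ⟩ := ((isFO_maxSat hdef φ id huniv).comp rightVar).exAssign
  obtain ⟨ψ, hψ, hψθ⟩ := θ.exists_closure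
  refine ⟨ψ, hψ, fun M _ RI => ?_⟩
  rw [hψθ]
  refine (forall_tsat_singleton_iff_exists_maxSat RI hup (fun _ => rfl) (fun _ => rfl)
    φ hφ).trans ?_
  simp only [← hθ, joinAssign_comp_rightVar, comp_id, forall_const]
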